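/- Let M be a countable transitive set with (M,∈) ⊨ ZF, let ⟨P,≼,𝟙⟩ ∈ M be a forcing notion, and let G be an M-generic filter on P. Then for every a ∈ M[G], the set 𝒫(a) ∩ M[G] (the collection of all subsets of a that belong to M[G]) is an element of M[G]. -/

import Mathlib

namespace CtmForcing

open FirstOrder FirstOrder.Language

/-! ### The first-order language of set theory -/

/-- The relation symbols of the language of set theory: a single binary relation `∈`. -/
inductive memRel : ℕ → Type
  | mem : memRel 2

/-- The first-order language `L` of set theory, with a single binary relation symbol `∈`. -/
def SetLang : Language := ⟨fun _ => Empty, memRel⟩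

/-- The membership relation symbol. -/
abbrev memSymb : SetLang.Relations 2 := .mem

/-- `L`-formulas (with no free "unbounded" variables) whose free variables are among
`v₀, …, v_{n-1}`. -/
abbrev BF (n : ℕ) := SetLang.BoundedFormula Empty n

/-- The atomic formula `vᵢ ∈ vⱼ`. -/
def memf {n : ℕ} (i j : Fin n) : BF n :=
  memSymb.boundedFormula₂ (Term.var (Sum.inr i)) (Term.var (Sum.inr j))

/-- The atomic formula `vᵢ = vⱼ`. -/
def eqf {n : ℕ} (i j : Fin n) : BF n :=
  Term.bdEqual (Term.var (Sum.inr i)) (Term.var (Sum.inr j))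

/-- Rename the free variables of a formula along `f`. -/
def reindex {m k : ℕ} (f : Fin m → Fin k) (φ : BF m) : BF k :=
  (BoundedFormula.relabel (Sum.map id f) φ.toFormula : SetLang.BoundedFormula Empty (k + 0))

/-- Conjunction. -/
def andF {n : ℕ} (φ ψ : BF n) : BF n := (φ.imp ψ.not).not

/-- Disjunction. -/
def orF {n : ℕ} (φ ψ : BF n) : BF n := (φ.not).imp ψ

/-- Biimplication. -/
def iffF {n : ℕ} (φ ψ : BF n) : BF n := andF (φ.imp ψ) (ψ.imp φ)

/-! ### Basic set-theoretic formulas -/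

/-- `v₀ ⊆ v₁`. -/
def subF : BF 2 := ((memf 2 0).imp (memf 2 1)).all

/-- `v₀ = ∅`. -/
def emptyF : BF 1 := ((memf 1 0).not).all

/-- `v₂ = {v₀, v₁}`. -/
def pairSetF : BF 3 := (iffF (memf 3 2) (orF (eqf 3 0) (eqf 3 1))).all

/-- `v₁ = {v₀}`. -/
def singF : BF 2 := reindex ![0, 0, 1] pairSetF

/-- `v₂ = ⟨v₀, v₁⟩` (Kuratowski ordered pair). -/
def opF : BF 3 :=
  (iffF (memf 3 2) (orF (reindex ![0, 3] singF) (reindex ![0, 1, 3] pairSetF))).all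

/-- `v₁ = v₀ ∪ {v₀}`. -/
def succF : BF 2 := (iffF (memf 2 1) (orF (memf 2 0) (eqf 2 0))).all

/-- `v₀` is transitive. -/
def transF : BF 1 := ((memf 1 0).imp (reindex ![1, 0] subF)).all

/-- `v₀` is an ordinal (a transitive set of transitive sets). -/
def ordF : BF 1 := andF transF (((memf 1 0).imp (reindex ![1] transF)).all)

/-- `⟨v₀, v₁⟩ ∈ v₂`. -/
def relMemF : BF 3 := (andF (reindex ![0, 1, 3] opF) (memf 3 2)).ex

/-- `v₂` is a function with domain `v₀` mapping onto `v₁` (a surjection from `v₀` onto `v₁`). -/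
def isFuncF : BF 3 :=
  andF
    (andF
      -- v₂ ⊆ v₀ × v₁
      (((memf 3 2).imp
        (((andF (andF (memf 4 0) (memf 5 1)) (reindex ![4, 5, 3] opF)).ex).ex)).all)
      -- total on v₀
      (((memf 3 0).imp ((andF (memf 4 1) (reindex ![3, 4, 2] relMemF)).ex)).all))
    (andF
      -- functional
      ((((andF (reindex ![3, 4, 2] relMemF) (reindex ![3, 5, 2] relMemF)).imp
          (eqf 4 5)).all).all.all)
      -- onto v₁
      (((memf 3 1).imp ((andF (memf 4 0) (reindex ![4, 3, 2] relMemF)).ex)).all))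

/-- `v₂` is injective (as a set of ordered pairs). -/
def injF : BF 3 :=
  ((((andF (reindex ![3, 5, 2] relMemF) (reindex ![4, 5, 2] relMemF)).imp
      (eqf 3 4)).all).all).all

/-- `v₂` is a bijection from `v₀` onto `v₁`. -/
def bijF : BF 3 := andF isFuncF injF

/-! ### The axioms of set theory as `L`-sentences -/

/-- Extensionality. -/
def extAx : SetLang.Sentence :=
  ((((andF subF (reindex ![1, 0] subF)).imp (eqf 0 1)).all).all : BF 0)

/-- Foundation. -/
def foundAx : SetLang.Sentence :=
  (((((memf 1 0).ex).imp
    ((andF (memf 1 0) (((memf 2 0).imp ((memf 2 1).not)).all)).ex)).all) : BF 0)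

/-- Pairing. -/
def pairAx : SetLang.Sentence := (((pairSetF.ex).all).all : BF 0)

/-- Union. -/
def unionAx : SetLang.Sentence :=
  (((((iffF (memf 2 1) ((andF (memf 3 0) (memf 2 3)).ex)).all).ex).all : BF 0))

/-- Powerset. -/
def powF : BF 2 := (iffF (memf 2 1) (reindex ![2, 0] subF)).all

/-- Powerset axiom. -/
def powAx : SetLang.Sentence := (((powF.ex).all) : BF 0)

/-- Infinity. -/
def infAx : SetLang.Sentence :=
  (((andF ((andF (memf 1 0) (reindex ![1] emptyF)).ex)
    (((memf 1 0).imp ((andF (memf 2 0) (reindex ![1, 2] succF)).ex)).all)).ex) : BF 0)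

/-- The instance of the Separation scheme given by `φ`, whose free variables are among
`v₀, …, vₙ`: the parameters are `v₀, …, v_{n-1}` and the tested element is `vₙ`.  It is the
universal closure of `∀A ∃B ∀x (x ∈ B ↔ x ∈ A ∧ φ(params, x))`. -/
def sepAx {n : ℕ} (φ : BF (n + 1)) : SetLang.Sentence :=
  -- context `n+3`: parameters `0,…,n-1`, `A = n`, `B = n+1`, `x = n+2`
  let A : Fin (n + 3) := ⟨n, by omega⟩
  let B : Fin (n + 3) := ⟨n + 1, by omega⟩
  let x : Fin (n + 3) := ⟨n + 2, by omega⟩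
  let φ' : BF (n + 3) := reindex (fun i => if h : (i : ℕ) < n then ⟨i, by omega⟩ else x) φ
  ((((iffF (memf x B) (andF (memf x A) φ')).all).ex).all).alls

/-- The instance of the Replacement scheme given by `φ`, whose free variables are among
`v₀, …, v_{n+1}`: the parameters are `v₀, …, v_{n-1}`, the argument is `x = vₙ`, and the
value is `y = v_{n+1}`.  It is the universal closure of
`∀A [(∀x∈A ∀y ∀y' (φ(x,y) ∧ φ(x,y') → y = y')) → ∃B ∀y (y ∈ B ↔ ∃x∈A φ(x,y))]`. -/
def replAx {n : ℕ} (φ : BF (n + 2)) : SetLang.Sentence :=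
  -- functionality context `n+4`: parameters, `A = n`, `x = n+1`, `y = n+2`, `y' = n+3`
  let A : Fin (n + 4) := ⟨n, by omega⟩
  let x : Fin (n + 4) := ⟨n + 1, by omega⟩
  let y : Fin (n + 4) := ⟨n + 2, by omega⟩
  let y' : Fin (n + 4) := ⟨n + 3, by omega⟩
  let φ₁ : BF (n + 4) :=
    reindex (fun i => if h : (i : ℕ) < n then ⟨i, by omega⟩ else if (i : ℕ) = n then x else y) φ
  let φ₂ : BF (n + 4) :=
    reindex (fun i => if h : (i : ℕ) < n then ⟨i, by omega⟩ else if (i : ℕ) = n then x else y') φ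
  let funcl : BF (n + 1) :=
    ((((andF (memf x A) (andF φ₁ φ₂)).imp (eqf y y')).all).all).all
  -- image context `n+4`: parameters, `A = n`, `B = n+1`, `y = n+2`, `x = n+3`
  let xi : Fin (n + 4) := ⟨n + 3, by omega⟩
  let yi : Fin (n + 4) := ⟨n + 2, by omega⟩
  let B3 : Fin (n + 3) := ⟨n + 1, by omega⟩
  let y3 : Fin (n + 3) := ⟨n + 2, by omega⟩
  let φ₃ : BF (n + 4) :=
    reindex (fun i => if h : (i : ℕ) < n then ⟨i, by omega⟩ else if (i : ℕ) = n then xi else yi) φ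
  let image : BF (n + 1) :=
    (((iffF (memf y3 B3) ((andF (memf xi A) φ₃).ex)).all).ex)
  ((funcl.imp image).all).alls

/-- The Axiom of Choice: every set is the surjective image of an ordinal. -/
def acAx : SetLang.Sentence :=
  ((((andF (reindex ![1] ordF) (reindex ![1, 0, 2] isFuncF)).ex).ex).all : BF 0)

/-- `v₀ = ω`: `v₀` is an ordinal containing `∅`, closed under successors, each of whose
elements is `∅` or a successor. -/
def omegaF : BF 1 :=
  andF (andF ordF ((andF (memf 1 0) (reindex ![1] emptyF)).ex))
    (andF (((memf 1 0).imp ((andF (memf 2 0) (reindex ![1, 2] succF)).ex)).all)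
      (((memf 1 0).imp
        (orF (reindex ![1] emptyF) ((andF (memf 2 1) (reindex ![2, 1] succF)).ex))).all))

/-- Given `v₀ = ω`, `v₁ = ℵ₁`: `v₁` is an ordinal, there is no surjection from `ω` onto `v₁`,
and every element of `v₁` is empty or a surjective image of `ω`. -/
def alephOneF : BF 2 :=
  andF (andF (reindex ![1] ordF) (((reindex ![0, 1, 2] isFuncF).ex).not))
    (((memf 2 1).imp (orF (reindex ![2] emptyF) ((reindex ![0, 2, 3] isFuncF).ex))).all)

/-- The Continuum Hypothesis `ℵ₁ = 2^ℵ₀`: there is a bijection between `𝒫(ω)` and `ℵ₁`. -/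
def chSent : SetLang.Sentence :=
  (((((andF (andF (reindex ![0] omegaF) (reindex ![0, 1] powF))
      (andF (reindex ![0, 2] alephOneF) (reindex ![1, 2, 3] bijF))).ex).ex).ex).ex : BF 0)

/-! ### The theories `Z`, `ZF`, `ZC`, `ZFC` -/

/-- The finitely many non-scheme axioms of `ZF`. -/
def zfFin : SetLang.Theory := {extAx, foundAx, pairAx, unionAx, powAx, infAx}

/-- All instances of the Separation scheme. -/
def sepScheme : SetLang.Theory := Set.range fun p : Σ n, BF (n + 1) => sepAx p.2

/-- All instances of the Replacement scheme. -/
def replScheme : SetLang.Theory := Set.range fun p : Σ n, BF (n + 2) => replAx p.2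

/-- Zermelo set theory. -/
def Z : SetLang.Theory := zfFin ∪ sepScheme

/-- Zermelo–Fraenkel set theory. -/
def ZF : SetLang.Theory := Z ∪ replScheme

/-- Zermelo set theory with Choice. -/
def ZC : SetLang.Theory := Z ∪ {acAx}

/-- Zermelo–Fraenkel set theory with Choice. -/
def ZFC : SetLang.Theory := ZF ∪ {acAx}

/-! ### Satisfaction in a set with the true membership relation -/

/-- The `L`-structure on (the elements of) a `ZFSet` `M`, with `∈` interpreted as true
membership. -/
def zfStruct (M : ZFSet) : SetLang.Structure {x : ZFSet // x ∈ M} where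
  funMap := fun f _ => f.elim
  RelMap | .mem => fun v => ((v 0 : {x : ZFSet // x ∈ M}) : ZFSet) ∈ ((v 1 : {x : ZFSet // x ∈ M}) : ZFSet)

/-- `(M, ∈) ⊨ T`: the structure on `M` with true membership satisfies every sentence of `T`. -/
def ZModels (M : ZFSet) (T : SetLang.Theory) : Prop :=
  ∀ φ ∈ T, letI := zfStruct M; Sentence.Realize (M := {x : ZFSet // x ∈ M}) φ

/-- `(M, ∈) ⊨ φ[v₀, …, v_{k-1}]`: satisfaction of the formula `φ` in `M`, with the
(membership-checked) valuation `v` of its free variables. -/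
def ZRealize (M : ZFSet) {k : ℕ} (φ : BF k) (v : Fin k → ZFSet) : Prop :=
  ∀ h : ∀ i, v i ∈ M,
    letI := zfStruct M
    BoundedFormula.Realize (M := {x : ZFSet // x ∈ M}) φ (fun e => e.elim) (fun i => ⟨v i, h i⟩)

/-- `x` is a (von Neumann) ordinal: a transitive set of transitive sets. -/
def IsOrd (x : ZFSet) : Prop := x.IsTransitive ∧ ∀ y ∈ x, ZFSet.IsTransitive y


/-! ### Forcing: names, values, generic extensions -/

/-- The value `val(G, τ)` of a name `τ` under `G`, defined by `∈`-recursion: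
`val(G, τ) = { val(G, σ) : ∃ p ∈ G, ⟨σ, p⟩ ∈ τ }`. -/
noncomputable def zval (G : ZFSet) : ZFSet → ZFSet :=
  (InvImage.wf ZFSet.rank Ordinal.lt_wf).fix fun τ ih =>
    letI : ∀ (n : ℕ) (f : (Fin n → ZFSet) → ZFSet), ZFSet.Definable n f := fun _ _ => Classical.allZFSetDefinable _
    ZFSet.image (fun σ => if h : ZFSet.rank σ < ZFSet.rank τ then ih σ h else ∅)
      (ZFSet.sep (fun σ => ∃ p ∈ G, ZFSet.pair σ p ∈ τ) (ZFSet.sUnion (ZFSet.sUnion τ)))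

/-- The generic extension `M[G] = { val(G, τ) : τ ∈ M }`. -/
noncomputable def genExt (M G : ZFSet) : ZFSet :=
  letI : ∀ (n : ℕ) (f : (Fin n → ZFSet) → ZFSet), ZFSet.Definable n f := fun _ _ => Classical.allZFSetDefinable _
  ZFSet.image (zval G) M

/-- `⟨P, r, one⟩` is a forcing notion belonging to `M`: `r ∈ M` is (the graph of) a preorder
on `P ∈ M` with greatest element `one`. -/
def ForcingNotion (M P r one : ZFSet) : Prop :=
  P ∈ M ∧ r ∈ M ∧ one ∈ P ∧
    (∀ q ∈ r, ∃ a ∈ P, ∃ b ∈ P, q = ZFSet.pair a b) ∧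
    (∀ p ∈ P, ZFSet.pair p p ∈ r) ∧
    (∀ p ∈ P, ∀ q ∈ P, ∀ s ∈ P, ZFSet.pair p q ∈ r → ZFSet.pair q s ∈ r →
      ZFSet.pair p s ∈ r) ∧
    (∀ p ∈ P, ZFSet.pair p one ∈ r)

/-- `D` is a dense subset of the forcing notion `⟨P, r⟩`. -/
def IsDenseIn (r P D : ZFSet) : Prop :=
  D ⊆ P ∧ ∀ p ∈ P, ∃ d ∈ D, ZFSet.pair d p ∈ r

/-- `G` is a filter on `⟨P, r⟩`: upward closed and downward directed. -/
def IsFilterOn (r P G : ZFSet) : Prop :=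
  G ⊆ P ∧ (∀ x ∈ G, ∀ y ∈ P, ZFSet.pair x y ∈ r → y ∈ G) ∧
    (∀ x ∈ G, ∀ y ∈ G, ∃ z ∈ G, ZFSet.pair z x ∈ r ∧ ZFSet.pair z y ∈ r)

/-- `G` is an `M`-generic filter on `⟨P, r⟩`: a filter meeting every dense subset of `P`
that belongs to `M`. -/
def IsGeneric (M r P G : ZFSet) : Prop :=
  IsFilterOn r P G ∧ ∀ D ∈ M, IsDenseIn r P D → ∃ q ∈ G, q ∈ D


section Aux

/-! ### Semantics of the syntactic abbreviations -/

attribute [local instance] zfStruct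

universe u

/-- The underlying type of the model. -/
abbrev XM (M : ZFSet.{u}) : Type (u + 1) := {x : ZFSet.{u} // x ∈ M}

section Sem

variable {M : ZFSet.{u}}

theorem real_memf {n : ℕ} (i j : Fin n) (e : Empty → XM M) (v : Fin n → XM M) :
    (memf i j).Realize e v ↔ (v i).1 ∈ (v j).1 := by
  unfold memf
  rw [BoundedFormula.realize_rel₂]
  rfl

theorem real_eqf {n : ℕ} (i j : Fin n) (e : Empty → XM M) (v : Fin n → XM M) :
    (eqf i j).Realize e v ↔ v i = v j := by
  unfold eqf
  rw [BoundedFormula.realize_bdEqual]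
  rfl

theorem real_andF {n : ℕ} (φ ψ : BF n) (e : Empty → XM M) (v : Fin n → XM M) :
    (andF φ ψ).Realize e v ↔ φ.Realize e v ∧ ψ.Realize e v := by
  unfold andF
  simp only [BoundedFormula.realize_not, BoundedFormula.realize_imp]
  tauto

theorem real_orF {n : ℕ} (φ ψ : BF n) (e : Empty → XM M) (v : Fin n → XM M) :
    (orF φ ψ).Realize e v ↔ φ.Realize e v ∨ ψ.Realize e v := by
  unfold orF
  simp only [BoundedFormula.realize_not, BoundedFormula.realize_imp]
  tauto

theorem real_iffF {n : ℕ} (φ ψ : BF n) (e : Empty → XM M) (v : Fin n → XM M) :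
    (iffF φ ψ).Realize e v ↔ (φ.Realize e v ↔ ψ.Realize e v) := by
  unfold iffF
  simp only [real_andF, BoundedFormula.realize_imp]
  tauto

theorem real_reindex {m k : ℕ} (f : Fin m → Fin k) (φ : BF m) (e : Empty → XM M)
    (v : Fin k → XM M) :
    (reindex f φ).Realize e v ↔ φ.Realize e (fun i => v (f i)) := by
  unfold reindex
  refine (BoundedFormula.realize_relabel (φ := φ.toFormula) (m := k) (n := 0)
    (g := Sum.map id f) (v := e) (xs := v)).trans ?_
  have := BoundedFormula.realize_toFormula φ
    (Sum.elim e (v ∘ Fin.castAdd 0) ∘ Sum.map (id : Empty → Empty) f)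
  rw [Formula.Realize] at this
  refine Iff.trans (iff_of_eq ?_) (this.trans (iff_of_eq ?_))
  · congr 1
    exact funext (fun i => i.elim0)
  · rfl

/-- transfer of formulas with parameters -/
theorem exists_param {n : ℕ} (φ : SetLang.BoundedFormula (XM M) n) :
    ∃ (m : ℕ) (c : Fin m → XM M) (ψ : BF (m + n)), ∀ (e : Empty → XM M) (v : Fin n → XM M),
      ψ.Realize e (Fin.append c v) ↔ φ.Realize id v := by
  classical
  let s := φ.freeVarFinset
  let ε := s.equivFin
  refine ⟨s.card, fun i => (ε.symm i).1,
    (BoundedFormula.relabel (fun x : Fin s.card ⊕ Fin n =>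
        (Sum.inr (finSumFinEquiv x) : Empty ⊕ Fin (s.card + n)))
      (φ.restrictFreeVar (fun a => ε a)).toFormula :
      SetLang.BoundedFormula Empty (s.card + n + 0)), fun e v => ?_⟩
  let w : Fin (s.card + n) → XM M := Fin.append (fun i => ((ε.symm i).1 : XM M)) v
  refine (BoundedFormula.realize_relabel (m := s.card + n) (n := 0)
    (v := e) (xs := w)).trans ?_
  have := BoundedFormula.realize_toFormula (φ.restrictFreeVar (fun a => ε a))
    (Sum.elim e ((Fin.append (fun i => ((ε.symm i).1 : XM M)) v) ∘ Fin.castAdd 0) ∘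
      (fun x : Fin s.card ⊕ Fin n =>
        (Sum.inr (finSumFinEquiv x) : Empty ⊕ Fin (s.card + n))))
  rw [Formula.Realize] at this
  refine Iff.trans (iff_of_eq ?_) (this.trans ?_)
  · congr 1
    exact funext (fun i => i.elim0)
  · rw [BoundedFormula.realize_restrictFreeVar (v' := id)]
    · refine iff_of_eq ?_
      congr 1
      funext i
      simp
    · intro a
      simp

end Sem

/-! ### Definable predicates (with parameters) -/

/-- A context: a type of tuples of elements of the model. -/
class Ctx (M : ZFSet.{u}) (Γ : Type (u + 1)) where
  /-- length -/
  n : ℕ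
  /-- the tuple -/
  f : Γ → Fin n → XM M

instance ctxNil (M : ZFSet.{u}) : Ctx M PUnit.{u + 2} := ⟨0, fun _ i => i.elim0⟩

instance ctxCons (M : ZFSet.{u}) (Γ : Type (u + 1)) [Ctx M Γ] : Ctx M (Γ × XM M) :=
  ⟨Ctx.n M Γ + 1, fun g => Fin.snoc (Ctx.f g.1) g.2⟩

section Dfn

variable {M : ZFSet.{u}} {Γ : Type (u + 1)} [Ctx M Γ]

/-- definable terms (variables and constants) -/
def Tm (t : Γ → XM M) : Prop :=
  (∃ i, t = fun g => Ctx.f g i) ∨ ∃ c, t = fun _ => c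

/-- definable predicates -/
def Dfn (M : ZFSet.{u}) {Γ : Type (u + 1)} [Ctx M Γ] (R : Γ → Prop) : Prop :=
  ∃ φ : SetLang.BoundedFormula (XM M) (Ctx.n M Γ), ∀ g, R g ↔ φ.Realize id (Ctx.f g)

theorem Tm.c (c : XM M) : Tm (fun _ : Γ => c) := Or.inr ⟨c, rfl⟩

theorem Tm.v0 : Tm (fun g : Γ × XM M => g.2) :=
  Or.inl ⟨Fin.last _, by funext g; exact (Fin.snoc_last (α := fun _ => XM M) _ _).symm⟩

theorem Tm.up {t : Γ → XM M} (h : Tm t) : Tm (fun g : Γ × XM M => t g.1) := by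
  rcases h with ⟨i, rfl⟩ | ⟨c, rfl⟩
  · exact Or.inl ⟨Fin.castSucc i, by
      funext g; exact (Fin.snoc_castSucc (α := fun _ => XM M) _ _ _).symm⟩
  · exact Or.inr ⟨c, rfl⟩

theorem Tm.term {t : Γ → XM M} (h : Tm t) :
    ∃ s : SetLang.Term (XM M ⊕ Fin (Ctx.n M Γ)), ∀ g,
      t g = s.realize (Sum.elim id (Ctx.f g)) := by
  rcases h with ⟨i, rfl⟩ | ⟨c, rfl⟩
  · exact ⟨Term.var (Sum.inr i), fun g => rfl⟩
  · exact ⟨Term.var (Sum.inl c), fun g => rfl⟩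

theorem Dfn.mem {s t : Γ → XM M} (hs : Tm s) (ht : Tm t) :
    Dfn M (fun g => (s g).1 ∈ (t g).1) := by
  obtain ⟨a, ha⟩ := hs.term
  obtain ⟨b, hb⟩ := ht.term
  refine ⟨memSymb.boundedFormula₂ a b, fun g => ?_⟩
  rw [BoundedFormula.realize_rel₂, ← ha, ← hb]
  rfl

theorem Dfn.eq {s t : Γ → XM M} (hs : Tm s) (ht : Tm t) :
    Dfn M (fun g => s g = t g) := by
  obtain ⟨a, ha⟩ := hs.term
  obtain ⟨b, hb⟩ := ht.term
  refine ⟨Term.bdEqual a b, fun g => ?_⟩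
  rw [BoundedFormula.realize_bdEqual, ← ha, ← hb]

theorem Dfn.imp {A B : Γ → Prop} (hA : Dfn M A) (hB : Dfn M B) :
    Dfn M (fun g => A g → B g) := by
  obtain ⟨a, ha⟩ := hA
  obtain ⟨b, hb⟩ := hB
  exact ⟨a.imp b, fun g => by rw [BoundedFormula.realize_imp, ← ha, ← hb]⟩

theorem Dfn.not {A : Γ → Prop} (hA : Dfn M A) : Dfn M (fun g => ¬ A g) := by
  obtain ⟨a, ha⟩ := hA
  exact ⟨a.not, fun g => by rw [BoundedFormula.realize_not, ← ha]⟩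

theorem Dfn.congr {A B : Γ → Prop} (hA : Dfn M A) (h : ∀ g, B g ↔ A g) : Dfn M B := by
  obtain ⟨a, ha⟩ := hA
  exact ⟨a, fun g => (h g).trans (ha g)⟩

theorem Dfn.and {A B : Γ → Prop} (hA : Dfn M A) (hB : Dfn M B) :
    Dfn M (fun g => A g ∧ B g) :=
  (hA.imp hB.not).not.congr (fun g => by tauto)

theorem Dfn.or {A B : Γ → Prop} (hA : Dfn M A) (hB : Dfn M B) :
    Dfn M (fun g => A g ∨ B g) :=
  (hA.not.imp hB).congr (fun g => by tauto)

theorem Dfn.iff {A B : Γ → Prop} (hA : Dfn M A) (hB : Dfn M B) :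
    Dfn M (fun g => A g ↔ B g) :=
  ((hA.imp hB).and (hB.imp hA)).congr (fun g => by tauto)

theorem Dfn.all {A : Γ → XM M → Prop} (h : Dfn M (fun g : Γ × XM M => A g.1 g.2)) :
    Dfn M (fun g => ∀ x, A g x) := by
  obtain ⟨a, ha⟩ := h
  exact ⟨BoundedFormula.all a, fun g => by
    rw [BoundedFormula.realize_all]
    exact forall_congr' fun x => ha (g, x)⟩

theorem Dfn.ex {A : Γ → XM M → Prop} (h : Dfn M (fun g : Γ × XM M => A g.1 g.2)) :
    Dfn M (fun g => ∃ x, A g x) := by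
  obtain ⟨a, ha⟩ := h
  exact ⟨BoundedFormula.ex a, fun g => by
    rw [BoundedFormula.realize_ex]
    exact exists_congr fun x => ha (g, x)⟩

theorem Dfn.one {R : XM M → Prop} (hR : Dfn M (fun g : PUnit.{u + 2} × XM M => R g.2)) :
    ∃ φ : SetLang.BoundedFormula (XM M) 1, ∀ x, R x ↔ φ.Realize id ![x] := by
  obtain ⟨φ, hφ⟩ := hR
  refine ⟨φ, fun x => ?_⟩
  have hφ' : R x ↔ _ := hφ (PUnit.unit, x)
  rw [hφ']
  refine iff_of_eq (congrArg _ ?_)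
  funext i
  revert i
  show ∀ i : Fin 1, _
  intro i
  fin_cases i
  rfl

theorem Dfn.two {R : XM M → XM M → Prop}
    (hR : Dfn M (fun g : (PUnit.{u + 2} × XM M) × XM M => R g.1.2 g.2)) :
    ∃ φ : SetLang.BoundedFormula (XM M) 2, ∀ x y, R x y ↔ φ.Realize id ![x, y] := by
  obtain ⟨φ, hφ⟩ := hR
  refine ⟨φ, fun x y => ?_⟩
  have hφ' : R x y ↔ _ := hφ ((PUnit.unit, x), y)
  rw [hφ']
  refine iff_of_eq (congrArg _ ?_)
  funext i
  revert i
  show ∀ i : Fin 2, _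
  intro i
  fin_cases i <;> rfl

end Dfn

/-! ### Closure properties of models -/

section Closure

variable {M : ZFSet.{u}}

/-- `M` is a transitive model of `ZF`. -/
def TZ (M : ZFSet.{u}) : Prop := M.IsTransitive ∧ ZModels M ZF

theorem TZ.tr (H : TZ M) {x y : ZFSet.{u}} (h : x ∈ y) (hy : y ∈ M) : x ∈ M := H.1 y hy h

theorem TZ.sep_mem (H : TZ M) {R : XM M → Prop} (hR : Dfn M (fun g : PUnit.{u + 2} × XM M => R g.2))
    {A : ZFSet.{u}} (hA : A ∈ M) :
    ∃ B ∈ M, ∀ x : XM M, x.1 ∈ B ↔ x.1 ∈ A ∧ R x := by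
  obtain ⟨φ, hφ⟩ := hR.one
  obtain ⟨m, c, ψ, hψ⟩ := exists_param φ
  have hax := H.2 (sepAx (n := m) ψ) (Or.inl (Or.inr ⟨⟨m, ψ⟩, rfl⟩))
  unfold sepAx at hax
  have h2 := (BoundedFormula.realize_alls.1 hax) c ⟨A, hA⟩
  rw [BoundedFormula.realize_ex] at h2
  obtain ⟨B, hB⟩ := h2
  refine ⟨B.1, B.2, fun x => ?_⟩
  have h3 := hB x
  rw [real_iffF, real_andF, real_memf, real_memf, real_reindex] at h3
  have e1 : (Fin.snoc (Fin.snoc (Fin.snoc c ⟨A, hA⟩) B) x : Fin (m + 3) → XM M)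
      ⟨m, by omega⟩ = ⟨A, hA⟩ := by
    simp [Fin.snoc]
  have e2 : (Fin.snoc (Fin.snoc (Fin.snoc c ⟨A, hA⟩) B) x : Fin (m + 3) → XM M)
      ⟨m + 1, by omega⟩ = B := by
    simp [Fin.snoc]
  have e3 : (Fin.snoc (Fin.snoc (Fin.snoc c ⟨A, hA⟩) B) x : Fin (m + 3) → XM M)
      ⟨m + 2, by omega⟩ = x := by
    simp [Fin.snoc]
  rw [e1, e2, e3] at h3
  rw [h3, hφ x, ← hψ default]
  refine and_congr_right fun _ => iff_of_eq ?_
  congr 1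
  funext i
  refine Fin.addCases (fun j => ?_) (fun j => ?_) i
  · have : (j : ℕ) < m := j.2
    simp [Fin.snoc, Fin.append_left]
    intro h; omega
  · have : j = Fin.last 0 := Subsingleton.elim _ _
    subst this
    rw [Fin.append_right]
    simp [Fin.snoc]

theorem TZ.repl_mem (H : TZ M) {R : XM M → XM M → Prop}
    (hR : Dfn M (fun g : (PUnit.{u + 2} × XM M) × XM M => R g.1.2 g.2))
    {A : ZFSet.{u}} (hA : A ∈ M)
    (hfun : ∀ x y z : XM M, x.1 ∈ A → R x y → R x z → y = z) :
    ∃ B ∈ M, ∀ y : XM M, y.1 ∈ B ↔ ∃ x : XM M, x.1 ∈ A ∧ R x y := by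
  obtain ⟨φ, hφ⟩ := hR.two
  obtain ⟨m, c, ψ, hψ⟩ := exists_param φ
  have hax := H.2 (replAx (n := m) ψ) (Or.inr ⟨⟨m, ψ⟩, rfl⟩)
  unfold replAx at hax
  have h2 := (BoundedFormula.realize_alls.1 hax) c ⟨A, hA⟩
  rw [BoundedFormula.realize_imp] at h2
  have key : ∀ (w : Fin (m + 2) → XM M) (e : Empty → XM M) (x y : XM M),
      (∀ i : Fin m, w ⟨i, by omega⟩ = c i) → w ⟨m, by omega⟩ = x → w ⟨m + 1, by omega⟩ = y →
      (BoundedFormula.Realize ψ e w ↔ R x y) := by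
    intro w e x y h1 h2 h3
    rw [hφ x y, ← hψ e]
    refine iff_of_eq ?_
    congr 1
    funext i
    refine Fin.addCases (fun j => ?_) (fun j => ?_) i
    · rw [Fin.append_left]
      exact h1 j
    · rw [Fin.append_right]
      fin_cases j
      · exact h2
      · exact h3
  have h3 := h2 (by
    intro x y z
    rw [BoundedFormula.realize_imp, real_andF, real_andF, real_reindex, real_reindex, real_memf,
      real_eqf, key _ _ x y, key _ _ x z]
    · rintro ⟨hx, h1, h2⟩
      have := hfun x y z (by
        have e : m ≤ m + 1 + 1 := by omega
        simpa [Fin.snoc, e] using hx) h1 h2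
      simpa [Fin.snoc] using this
    · intro i
      have := i.2
      simp [Fin.snoc]
      rw [if_pos (by omega), if_pos (by omega)]
    · simp [Fin.snoc]
    · simp [Fin.snoc]
    · intro i
      have := i.2
      simp [Fin.snoc]
      rw [if_pos (by omega), if_pos (by omega)]
    · simp [Fin.snoc]
    · simp [Fin.snoc])
  rw [BoundedFormula.realize_ex] at h3
  obtain ⟨B, hB⟩ := h3
  refine ⟨B.1, B.2, fun y => ?_⟩
  have h4 := hB y
  rw [real_iffF, real_memf, BoundedFormula.realize_ex] at h4
  have e1 : (Fin.snoc (Fin.snoc (Fin.snoc c ⟨A, hA⟩) B) y : Fin (m + 3) → XM M)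
      ⟨m + 2, by omega⟩ = y := by
    simp [Fin.snoc]
  have e2 : (Fin.snoc (Fin.snoc (Fin.snoc c ⟨A, hA⟩) B) y : Fin (m + 3) → XM M)
      ⟨m + 1, by omega⟩ = B := by
    simp [Fin.snoc]
  rw [e1, e2] at h4
  rw [h4]
  refine exists_congr fun x => ?_
  rw [real_andF, real_memf, real_reindex, key _ _ x y]
  · have e : m ≤ m + 1 + 1 := by omega
    simp [Fin.snoc, e]
  · intro i
    have := i.2
    simp [Fin.snoc]
    rw [if_pos (by omega), if_pos (by omega)]
  · simp [Fin.snoc]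
  · simp [Fin.snoc]

theorem TZ.upair_mem (H : TZ M) {a b : ZFSet.{u}} (ha : a ∈ M) (hb : b ∈ M) : ({a, b} : ZFSet.{u}) ∈ M := by
  have hax := H.2 pairAx (Or.inl (Or.inl (by simp [zfFin])))
  have h2 := hax ⟨a, ha⟩ ⟨b, hb⟩
  unfold pairSetF at h2
  rw [BoundedFormula.realize_ex] at h2
  obtain ⟨c, hc⟩ := h2
  have : c.1 = {a, b} := by
    have h3 : ∀ x : XM M, x.1 ∈ c.1 ↔ x.1 = a ∨ x.1 = b := by
      intro x
      have := hc x
      rw [real_iffF, real_orF, real_memf, real_eqf, real_eqf, Subtype.ext_iff, Subtype.ext_iff]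
        at this
      exact this
    ext x
    rw [ZFSet.mem_pair]
    refine ⟨fun h => (h3 ⟨x, H.tr h c.2⟩).1 h, fun h => ?_⟩
    rcases h with rfl | rfl
    · exact (h3 ⟨x, ha⟩).2 (Or.inl rfl)
    · exact (h3 ⟨x, hb⟩).2 (Or.inr rfl)
  exact this ▸ c.2

theorem TZ.sUnion_mem (H : TZ M) {a : ZFSet.{u}} (ha : a ∈ M) : ZFSet.sUnion a ∈ M := by
  have hax := H.2 unionAx (Or.inl (Or.inl (by simp [zfFin])))
  have h2 := hax ⟨a, ha⟩
  rw [BoundedFormula.realize_ex] at h2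
  obtain ⟨c, hc⟩ := h2
  have : c.1 = ZFSet.sUnion a := by
    have h3 : ∀ x : XM M, x.1 ∈ c.1 ↔ ∃ y : XM M, y.1 ∈ a ∧ x.1 ∈ y.1 := by
      intro x
      have := hc x
      rw [real_iffF, real_memf, BoundedFormula.realize_ex] at this
      simp only [real_andF, real_memf] at this
      exact this
    ext x
    rw [ZFSet.mem_sUnion]
    refine ⟨fun h => ?_, fun h => ?_⟩
    · obtain ⟨y, h1, h2⟩ := (h3 ⟨x, H.tr h c.2⟩).1 h
      exact ⟨y.1, h1, h2⟩
    · obtain ⟨y, h1, h2⟩ := h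
      have hy := H.tr h1 ha
      exact (h3 ⟨x, H.tr h2 hy⟩).2 ⟨⟨y, hy⟩, h1, h2⟩
  exact this ▸ c.2

theorem TZ.pow_mem (H : TZ M) {a : ZFSet.{u}} (ha : a ∈ M) : ∃ b ∈ M, ∀ x, x ∈ b ↔ x ∈ M ∧ x ⊆ a := by
  have hax := H.2 powAx (Or.inl (Or.inl (by simp [zfFin])))
  have h2 := hax ⟨a, ha⟩
  rw [BoundedFormula.realize_ex] at h2
  obtain ⟨c, hc⟩ := h2
  have h3 : ∀ x : XM M, x.1 ∈ c.1 ↔ ∀ y : XM M, y.1 ∈ x.1 → y.1 ∈ a := by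
    intro x
    have := hc x
    rw [real_iffF, real_memf, real_reindex] at this
    unfold subF at this
    simp only [BoundedFormula.realize_all, BoundedFormula.realize_imp, real_memf] at this
    exact this
  refine ⟨c.1, c.2, fun x => ⟨fun h => ?_, fun h => ?_⟩⟩
  · have hx := H.tr h c.2
    exact ⟨hx, fun y hy => (h3 ⟨x, hx⟩).1 h ⟨y, H.tr hy hx⟩ hy⟩
  · exact (h3 ⟨x, h.1⟩).2 fun y hy => h.2 hy

end Closure


section Closure2

variable {M : ZFSet.{u}}

theorem TZ.pair_mem (H : TZ M) {a b : ZFSet.{u}} (ha : a ∈ M) (hb : b ∈ M) :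
    ZFSet.pair a b ∈ M := by
  unfold ZFSet.pair
  refine H.upair_mem ?_ (H.upair_mem ha hb)
  have := H.upair_mem ha ha
  rwa [ZFSet.pair_eq_singleton] at this

theorem TZ.sing_mem (H : TZ M) {a : ZFSet.{u}} (ha : a ∈ M) : ({a} : ZFSet.{u}) ∈ M := by
  have := H.upair_mem ha ha
  rwa [ZFSet.pair_eq_singleton] at this

theorem TZ.union_mem (H : TZ M) {a b : ZFSet.{u}} (ha : a ∈ M) (hb : b ∈ M) : a ∪ b ∈ M := by
  have := H.sUnion_mem (H.upair_mem ha hb)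
  rwa [ZFSet.sUnion_pair] at this

theorem TZ.of_pair (H : TZ M) {a b : ZFSet.{u}} (h : ZFSet.pair a b ∈ M) : a ∈ M ∧ b ∈ M := by
  have h1 : ({a, b} : ZFSet.{u}) ∈ M := H.tr (by unfold ZFSet.pair; simp) h
  exact ⟨H.tr (by simp) h1, H.tr (by simp) h1⟩

theorem TZ.ext (H : TZ M) {a b : ZFSet.{u}} (ha : a ∈ M) (hb : b ∈ M)
    (h : ∀ x : XM M, x.1 ∈ a ↔ x.1 ∈ b) : a = b := by
  ext x
  exact ⟨fun hx => (h ⟨x, H.tr hx ha⟩).1 hx, fun hx => (h ⟨x, H.tr hx hb⟩).2 hx⟩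

/-- `⟨x, y⟩ ∈ z`. -/
def PM (x y z : XM M) : Prop := ZFSet.pair x.1 y.1 ∈ z.1

/-- `z = {x, y}`. -/
def UEq (x y z : XM M) : Prop := z.1 = {x.1, y.1}

/-- `z = ⟨x, y⟩`. -/
def PEq (x y z : XM M) : Prop := z.1 = ZFSet.pair x.1 y.1

/-- `w = ⟨x, ⟨y, z⟩⟩`. -/
def TEq (x y z w : XM M) : Prop := w.1 = ZFSet.pair x.1 (ZFSet.pair y.1 z.1)

/-- `⟨x, ⟨y, z⟩⟩ ∈ w`. -/
def TMem (x y z w : XM M) : Prop := ZFSet.pair x.1 (ZFSet.pair y.1 z.1) ∈ w.1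

/-- `x ⊆ y`. -/
def Sub (x y : XM M) : Prop := ∀ z : XM M, z.1 ∈ x.1 → z.1 ∈ y.1

theorem TZ.sub_iff (H : TZ M) {x y : XM M} : Sub x y ↔ x.1 ⊆ y.1 :=
  ⟨fun h z hz => h ⟨z, H.tr hz x.2⟩ hz, fun h _ hz => h hz⟩

variable {Γ : Type (u + 1)} [Ctx M Γ]

theorem TZ.dfn_U (H : TZ M) {a b c : Γ → XM M} (ha : Tm a) (hb : Tm b) (hc : Tm c) :
    Dfn M (fun g => UEq (a g) (b g) (c g)) := by
  refine Dfn.congr (Dfn.all (A := fun g x => x.1 ∈ (c g).1 ↔ x = a g ∨ x = b g)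
    (Dfn.iff (Dfn.mem Tm.v0 hc.up) (Dfn.or (Dfn.eq Tm.v0 ha.up) (Dfn.eq Tm.v0 hb.up)))) ?_
  intro g
  constructor
  · intro h x
    rw [h, ZFSet.mem_pair, Subtype.ext_iff, Subtype.ext_iff]
  · intro h
    refine H.ext (c g).2 (H.upair_mem (a g).2 (b g).2) fun x => ?_
    rw [h, ZFSet.mem_pair, Subtype.ext_iff, Subtype.ext_iff]

theorem TZ.dfn_PEq (H : TZ M) {a b c : Γ → XM M} (ha : Tm a) (hb : Tm b) (hc : Tm c) :
    Dfn M (fun g => PEq (a g) (b g) (c g)) := by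
  refine Dfn.congr (Dfn.ex (A := fun g x => ∃ y, UEq (a g) (a g) x ∧ UEq (a g) (b g) y ∧
      UEq x y (c g)) (Dfn.ex ((H.dfn_U ha.up.up ha.up.up Tm.v0.up).and
      ((H.dfn_U ha.up.up hb.up.up Tm.v0).and (H.dfn_U Tm.v0.up Tm.v0 hc.up.up))))) ?_
  intro g
  constructor
  · intro h
    refine ⟨⟨_, H.upair_mem (a g).2 (a g).2⟩, ⟨_, H.upair_mem (a g).2 (b g).2⟩, rfl, rfl, ?_⟩
    unfold UEq
    rw [h]
    simp [ZFSet.pair]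
  · rintro ⟨x, y, h1, h2, h3⟩
    unfold UEq at *
    unfold PEq
    rw [h3, h1, h2]
    simp [ZFSet.pair]

theorem TZ.dfn_PM (H : TZ M) {a b c : Γ → XM M} (ha : Tm a) (hb : Tm b) (hc : Tm c) :
    Dfn M (fun g => PM (a g) (b g) (c g)) := by
  refine Dfn.congr (Dfn.ex (A := fun g x => PEq (a g) (b g) x ∧ x.1 ∈ (c g).1)
    ((H.dfn_PEq ha.up hb.up Tm.v0).and (Dfn.mem Tm.v0 hc.up))) ?_
  intro g
  constructor
  · intro h
    exact ⟨⟨_, H.pair_mem (a g).2 (b g).2⟩, rfl, h⟩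
  · rintro ⟨x, h1, h2⟩
    unfold PEq at h1
    unfold PM
    rwa [← h1]

theorem TZ.dfn_TM (H : TZ M) {a b c d : Γ → XM M} (ha : Tm a) (hb : Tm b) (hc : Tm c)
    (hd : Tm d) : Dfn M (fun g => TMem (a g) (b g) (c g) (d g)) := by
  refine Dfn.congr (Dfn.ex (A := fun g x => PEq (b g) (c g) x ∧ PM (a g) x (d g))
    ((H.dfn_PEq hb.up hc.up Tm.v0).and (H.dfn_PM ha.up Tm.v0 hd.up))) ?_
  intro g
  constructor
  · intro h
    exact ⟨⟨_, H.pair_mem (b g).2 (c g).2⟩, rfl, h⟩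
  · rintro ⟨x, h1, h2⟩
    unfold PEq at h1
    unfold PM at h2
    unfold TMem
    rwa [← h1]

theorem TZ.dfn_TEq (H : TZ M) {a b c d : Γ → XM M} (ha : Tm a) (hb : Tm b) (hc : Tm c)
    (hd : Tm d) : Dfn M (fun g => TEq (a g) (b g) (c g) (d g)) := by
  refine Dfn.congr (Dfn.ex (A := fun g x => PEq (b g) (c g) x ∧ PEq (a g) x (d g))
    ((H.dfn_PEq hb.up hc.up Tm.v0).and (H.dfn_PEq ha.up Tm.v0 hd.up))) ?_
  intro g
  constructor
  · intro h
    exact ⟨⟨_, H.pair_mem (b g).2 (c g).2⟩, rfl, h⟩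
  · rintro ⟨x, h1, h2⟩
    unfold PEq at h1 h2
    unfold TEq
    rwa [← h1]

theorem dfn_Sub {a b : Γ → XM M} (ha : Tm a) (hb : Tm b) :
    Dfn M (fun g => Sub (a g) (b g)) :=
  Dfn.all (A := fun g z => z.1 ∈ (a g).1 → z.1 ∈ (b g).1)
    ((Dfn.mem Tm.v0 ha.up).imp (Dfn.mem Tm.v0 hb.up))

theorem TZ.prod_mem (H : TZ M) {A B : ZFSet.{u}} (hA : A ∈ M) (hB : B ∈ M) :
    ZFSet.prod A B ∈ M := by
  obtain ⟨C, hC, hC'⟩ := H.pow_mem (H.union_mem hA hB)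
  obtain ⟨D, hD, hD'⟩ := H.pow_mem hC
  obtain ⟨E, hE, hE'⟩ := H.sep_mem
    (R := fun z => ∃ a b : XM M, a.1 ∈ (⟨A, hA⟩ : XM M).1 ∧ b.1 ∈ (⟨B, hB⟩ : XM M).1 ∧ PEq a b z)
    (by
      refine Dfn.ex (Dfn.ex (Dfn.and (Dfn.mem Tm.v0.up (Tm.c _))
        (Dfn.and (Dfn.mem Tm.v0 (Tm.c _)) (H.dfn_PEq Tm.v0.up Tm.v0 Tm.v0.up.up)))))
    hD
  suffices E = ZFSet.prod A B from this ▸ hE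
  ext z
  rw [ZFSet.mem_prod]
  constructor
  · intro h
    obtain ⟨-, a, b, h1, h2, h3⟩ := (hE' ⟨z, H.tr h hE⟩).1 h
    exact ⟨a, h1, b, h2, h3⟩
  · rintro ⟨a, ha, b, hb, rfl⟩
    have haM := H.tr ha hA
    have hbM := H.tr hb hB
    refine (hE' ⟨_, H.pair_mem haM hbM⟩).2 ⟨?_, ⟨a, haM⟩, ⟨b, hbM⟩, ha, hb, rfl⟩
    refine (hD' _).2 ⟨H.pair_mem haM hbM, ?_⟩
    intro x hx
    refine (hC' x).2 ⟨H.tr hx (H.pair_mem haM hbM), ?_⟩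
    intro y hy
    simp only [ZFSet.pair, ZFSet.mem_pair] at hx
    rw [ZFSet.mem_union]
    rcases hx with rfl | rfl
    · rw [ZFSet.mem_singleton] at hy
      subst hy; exact Or.inl ha
    · rw [ZFSet.mem_pair] at hy
      rcases hy with rfl | rfl
      · exact Or.inl ha
      · exact Or.inr hb

/-- `z` is a transitive superset of `x` -/
def TSup (x z : XM M) : Prop := Sub x z ∧ ∀ y : XM M, y.1 ∈ z.1 → Sub y z

/-- `z` is the least transitive superset of `x` -/
def TCl (x z : XM M) : Prop := TSup x z ∧ ∀ w, TSup x w → Sub z w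

theorem dfn_TSup {a b : Γ → XM M} (ha : Tm a) (hb : Tm b) :
    Dfn M (fun g => TSup (a g) (b g)) :=
  (dfn_Sub ha hb).and (Dfn.all (A := fun g y => y.1 ∈ (b g).1 → Sub y (b g))
    ((Dfn.mem Tm.v0 hb.up).imp (dfn_Sub Tm.v0 hb.up)))

theorem dfn_TCl {a b : Γ → XM M} (ha : Tm a) (hb : Tm b) :
    Dfn M (fun g => TCl (a g) (b g)) :=
  (dfn_TSup ha hb).and (Dfn.all (A := fun g y => TSup (a g) y → Sub (b g) y)
    ((dfn_TSup ha.up Tm.v0).imp (dfn_Sub hb.up Tm.v0)))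

theorem TZ.exists_TCl (H : TZ M) (x : ZFSet.{u}) : ∀ hx : x ∈ M, ∃ z, TCl ⟨x, hx⟩ z := by
  induction x using ZFSet.inductionOn with
  | _ x ih =>
  intro hx
  obtain ⟨B, hB, hB'⟩ := H.repl_mem (R := TCl) (dfn_TCl Tm.v0.up Tm.v0) hx (by
    intro x y z _ h1 h2
    apply Subtype.ext
    exact H.ext y.2 z.2 fun w => ⟨fun h => h1.2 z h2.1 w h, fun h => h2.2 y h1.1 w h⟩)
  refine ⟨⟨x ∪ ZFSet.sUnion B, H.union_mem hx (H.sUnion_mem hB)⟩, ⟨?_, ?_⟩, ?_⟩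
  · intro z hz
    exact ZFSet.mem_union.2 (Or.inl hz)
  · intro y hy z hz
    refine ZFSet.mem_union.2 (Or.inr ?_)
    rw [ZFSet.mem_sUnion]
    rcases ZFSet.mem_union.1 hy with h | h
    · obtain ⟨c, hc⟩ := ih y.1 h y.2
      exact ⟨c.1, (hB' c).2 ⟨y, h, hc⟩, hc.1.1 z hz⟩
    · obtain ⟨c, hc, hyc⟩ := ZFSet.mem_sUnion.1 h
      obtain ⟨v, hv, hvc⟩ := (hB' ⟨c, H.tr hc hB⟩).1 hc
      exact ⟨c, hc, hvc.1.2 y hyc z hz⟩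
  · intro w hw z hz
    rcases ZFSet.mem_union.1 hz with h | h
    · exact hw.1 z h
    · obtain ⟨c, hc, hyc⟩ := ZFSet.mem_sUnion.1 h
      obtain ⟨v, hv, hvc⟩ := (hB' ⟨c, H.tr hc hB⟩).1 hc
      exact hvc.2 w ⟨hw.2 v (hw.1 v hv), hw.2⟩ z hyc

theorem TZ.exists_trans (H : TZ M) {a b : ZFSet.{u}} (ha : a ∈ M) (hb : b ∈ M) :
    ∃ T ∈ M, a ∈ T ∧ b ∈ T ∧ T.IsTransitive := by
  obtain ⟨z, ⟨hz1, hz2⟩, -⟩ := H.exists_TCl {a, b} (H.upair_mem ha hb)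
  exact ⟨z.1, z.2, hz1 ⟨a, ha⟩ (by simp), hz1 ⟨b, hb⟩ (by simp), fun y hy =>
    H.sub_iff.1 (hz2 ⟨y, H.tr hy z.2⟩ hy)⟩

/-- Greatest fixed points in `M`. -/
theorem TZ.exists_fix (H : TZ M) (W : XM M) (Ψ : XM M → XM M → Prop)
    (hΨ : ∀ (Γ : Type (u + 1)) [Ctx M Γ] (a b : Γ → XM M), Tm a → Tm b →
      Dfn M (fun g => Ψ (a g) (b g)))
    (mono : ∀ B C w, Sub B C → Ψ B w → Ψ C w) :
    ∃ B : XM M, ∀ w : XM M, w.1 ∈ B.1 ↔ w.1 ∈ W.1 ∧ Ψ B w := by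
  obtain ⟨B, hB, hB'⟩ := H.sep_mem
    (R := fun w => ∃ B : XM M, Sub B W ∧ (∀ v, v.1 ∈ B.1 → Ψ B v) ∧ w.1 ∈ B.1)
    (by
      refine Dfn.ex (Dfn.and (dfn_Sub Tm.v0 (Tm.c _)) (Dfn.and (Dfn.all (Dfn.imp
        (Dfn.mem Tm.v0 Tm.v0.up) (hΨ _ _ _ Tm.v0.up Tm.v0))) (Dfn.mem Tm.v0.up Tm.v0)))) W.2
  have post : ∀ w : XM M, w.1 ∈ B → Ψ ⟨B, hB⟩ w := by
    intro w hw
    obtain ⟨-, C, h1, h2, h3⟩ := (hB' w).1 hw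
    exact mono C _ w (fun z hz => (hB' z).2 ⟨h1 z hz, C, h1, h2, hz⟩) (h2 w h3)
  refine ⟨⟨B, hB⟩, fun w => ⟨fun h => ⟨((hB' w).1 h).1, post w h⟩, fun ⟨hw, h⟩ => ?_⟩⟩
  obtain ⟨C, hC, hC'⟩ := H.sep_mem (R := fun w => Ψ ⟨B, hB⟩ w) (hΨ _ _ _ (Tm.c _) Tm.v0) W.2
  refine (hB' w).2 ⟨hw, ⟨C, hC⟩, fun z hz => ((hC' z).1 hz).1, ?_, (hC' w).2 ⟨hw, h⟩⟩
  intro v hv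
  refine mono _ _ v ?_ ((hC' v).1 hv).2
  intro z hz
  exact (hC' z).2 ⟨((hB' z).1 hz).1, post z hz⟩

end Closure2


/-! ### Values of names -/

theorem rank_lt_of_pair {σ p τ : ZFSet.{u}} (h : ZFSet.pair σ p ∈ τ) :
    σ.rank < τ.rank := by
  have h1 := ZFSet.rank_lt_of_mem h
  have h2 : ({σ} : ZFSet.{u}).rank < (ZFSet.pair σ p).rank :=
    ZFSet.rank_lt_of_mem (by simp [ZFSet.pair])
  have h3 : σ.rank < ({σ} : ZFSet.{u}).rank := ZFSet.rank_lt_of_mem (by simp)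
  exact h3.trans (h2.trans h1)

theorem mem_zval {G τ x : ZFSet.{u}} :
    x ∈ zval G τ ↔ ∃ σ p, p ∈ G ∧ ZFSet.pair σ p ∈ τ ∧ zval G σ = x := by
  unfold zval
  rw [WellFounded.fix_eq]
  letI : ∀ (n : ℕ) (f : (Fin n → ZFSet.{u}) → ZFSet.{u}), ZFSet.Definable n f :=
    fun _ _ => Classical.allZFSetDefinable _
  rw [ZFSet.mem_image]
  constructor
  · rintro ⟨σ, hσ, h⟩
    rw [ZFSet.mem_sep] at hσ
    obtain ⟨-, p, hp, hm⟩ := hσ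
    have := rank_lt_of_pair hm
    rw [dif_pos this] at h
    exact ⟨σ, p, hp, hm, h⟩
  · rintro ⟨σ, p, hp, hm, h⟩
    refine ⟨σ, ?_, ?_⟩
    · rw [ZFSet.mem_sep]
      refine ⟨?_, p, hp, hm⟩
      rw [ZFSet.mem_sUnion]
      refine ⟨{σ}, ?_, by simp⟩
      rw [ZFSet.mem_sUnion]
      exact ⟨_, hm, by simp [ZFSet.pair]⟩
    · have := rank_lt_of_pair hm
      rw [dif_pos this]
      exact h

theorem mem_genExt {M G x : ZFSet.{u}} : x ∈ genExt M G ↔ ∃ τ ∈ M, zval G τ = x := by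
  unfold genExt
  letI : ∀ (n : ℕ) (f : (Fin n → ZFSet.{u}) → ZFSet.{u}), ZFSet.Definable n f :=
    fun _ _ => Classical.allZFSetDefinable _
  rw [ZFSet.mem_image]

/-! ### Forcing equality -/

section Forcing

variable {M : ZFSet.{u}}

/-- one half of forcing equality -/
def Fc (P r B p σ τ : XM M) : Prop :=
  ∀ σ' s q, PM σ' s σ → q.1 ∈ P.1 → PM q p r → PM q s r →
    ∃ r' τ' t, r'.1 ∈ P.1 ∧ PM r' q r ∧ PM τ' t τ ∧ PM r' t r ∧ TMem r' σ' τ' B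

/-- the other half of forcing equality -/
def Gc (P r B p σ τ : XM M) : Prop :=
  ∀ τ' t q, PM τ' t τ → q.1 ∈ P.1 → PM q p r → PM q t r →
    ∃ r' σ' s, r'.1 ∈ P.1 ∧ PM r' q r ∧ PM σ' s σ ∧ PM r' s r ∧ TMem r' σ' τ' B

theorem TZ.exists_forceEq (H : TZ M) (P r T : XM M) : ∃ B : XM M, ∀ p σ τ : XM M,
    TMem p σ τ B ↔ (p.1 ∈ P.1 ∧ σ.1 ∈ T.1 ∧ τ.1 ∈ T.1) ∧ Fc P r B p σ τ ∧ Gc P r B p σ τ := by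
  obtain ⟨B, hB⟩ := H.exists_fix
    ⟨ZFSet.prod P.1 (ZFSet.prod T.1 T.1), H.prod_mem P.2 (H.prod_mem T.2 T.2)⟩
    (fun B w => ∃ p σ τ : XM M, TEq p σ τ w ∧ Fc P r B p σ τ ∧ Gc P r B p σ τ)
    (by
      intro Γ _ a b ha hb
      unfold Fc Gc
      refine Dfn.ex (Dfn.ex (Dfn.ex (Dfn.and
        (H.dfn_TEq Tm.v0.up.up Tm.v0.up Tm.v0 hb.up.up.up) (Dfn.and ?_ ?_))))
      · refine Dfn.all (Dfn.all (Dfn.all (Dfn.imp ?_ (Dfn.imp ?_ (Dfn.imp ?_ (Dfn.imp ?_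
          (Dfn.ex (Dfn.ex (Dfn.ex (Dfn.and ?_ (Dfn.and ?_ (Dfn.and ?_ (Dfn.and ?_ ?_)))))))))))))
        · exact H.dfn_PM Tm.v0.up.up Tm.v0.up Tm.v0.up.up.up.up
        · exact Dfn.mem Tm.v0 (Tm.c _)
        · exact H.dfn_PM Tm.v0 Tm.v0.up.up.up.up.up (Tm.c _)
        · exact H.dfn_PM Tm.v0 Tm.v0.up (Tm.c _)
        · exact Dfn.mem Tm.v0.up.up (Tm.c _)
        · exact H.dfn_PM Tm.v0.up.up Tm.v0.up.up.up (Tm.c _)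
        · exact H.dfn_PM Tm.v0.up Tm.v0 Tm.v0.up.up.up.up.up.up
        · exact H.dfn_PM Tm.v0.up.up Tm.v0 (Tm.c _)
        · exact H.dfn_TM Tm.v0.up.up Tm.v0.up.up.up.up.up Tm.v0.up
            ha.up.up.up.up.up.up.up.up.up
      · refine Dfn.all (Dfn.all (Dfn.all (Dfn.imp ?_ (Dfn.imp ?_ (Dfn.imp ?_ (Dfn.imp ?_
          (Dfn.ex (Dfn.ex (Dfn.ex (Dfn.and ?_ (Dfn.and ?_ (Dfn.and ?_ (Dfn.and ?_ ?_)))))))))))))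
        · exact H.dfn_PM Tm.v0.up.up Tm.v0.up Tm.v0.up.up.up
        · exact Dfn.mem Tm.v0 (Tm.c _)
        · exact H.dfn_PM Tm.v0 Tm.v0.up.up.up.up.up (Tm.c _)
        · exact H.dfn_PM Tm.v0 Tm.v0.up (Tm.c _)
        · exact Dfn.mem Tm.v0.up.up (Tm.c _)
        · exact H.dfn_PM Tm.v0.up.up Tm.v0.up.up.up (Tm.c _)
        · exact H.dfn_PM Tm.v0.up Tm.v0 Tm.v0.up.up.up.up.up.up.up
        · exact H.dfn_PM Tm.v0.up.up Tm.v0 (Tm.c _)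
        · exact H.dfn_TM Tm.v0.up.up Tm.v0.up Tm.v0.up.up.up.up.up
            ha.up.up.up.up.up.up.up.up.up)
    (by
      rintro B C w hBC ⟨p, σ, τ, h1, h2, h3⟩
      have hm : ∀ x y z, TMem x y z B → TMem x y z C := fun x y z h => H.sub_iff.1 hBC h
      refine ⟨p, σ, τ, h1, ?_, ?_⟩
      · intro a b c d e f g
        obtain ⟨x, y, z, k1, k2, k3, k4, k5⟩ := h2 a b c d e f g
        exact ⟨x, y, z, k1, k2, k3, k4, hm _ _ _ k5⟩
      · intro a b c d e f g
        obtain ⟨x, y, z, k1, k2, k3, k4, k5⟩ := h3 a b c d e f g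
        exact ⟨x, y, z, k1, k2, k3, k4, hm _ _ _ k5⟩)
  refine ⟨B, fun p σ τ => ?_⟩
  have := hB ⟨ZFSet.pair p.1 (ZFSet.pair σ.1 τ.1), H.pair_mem p.2 (H.pair_mem σ.2 τ.2)⟩
  refine this.trans (and_congr ?_ ⟨?_, fun h => ⟨p, σ, τ, rfl, h⟩⟩)
  · show ZFSet.pair _ _ ∈ ZFSet.prod _ _ ↔ _
    rw [ZFSet.pair_mem_prod, ZFSet.pair_mem_prod]
  · rintro ⟨p', σ', τ', h1, h2⟩
    have h1 : ZFSet.pair p.1 (ZFSet.pair σ.1 τ.1) = ZFSet.pair p'.1 (ZFSet.pair σ'.1 τ'.1) := h1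
    rw [ZFSet.pair_inj, ZFSet.pair_inj] at h1
    obtain ⟨e1, e2, e3⟩ := h1
    have e1 := Subtype.ext e1
    have e2 := Subtype.ext e2
    have e3 := Subtype.ext e3
    subst e1 e2 e3
    exact h2

/-- The standing assumptions. -/
structure Setup (M : ZFSet.{u}) (P r : XM M) (one G : ZFSet.{u}) : Prop where
  H : TZ M
  hf : ForcingNotion M P.1 r.1 one
  hG : IsGeneric M r.1 P.1 G

variable {P r : XM M} {one G : ZFSet.{u}}

theorem Setup.le_mem (S : Setup M P r one G) {p q : XM M} (h : PM p q r) :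
    p.1 ∈ P.1 ∧ q.1 ∈ P.1 := by
  obtain ⟨a, ha, b, hb, e⟩ := S.hf.2.2.2.1 _ h
  rw [ZFSet.pair_inj] at e
  rw [e.1, e.2]
  exact ⟨ha, hb⟩

theorem Setup.trans (S : Setup M P r one G) {p q s : XM M} (h : PM p q r) (h' : PM q s r) :
    PM p s r :=
  S.hf.2.2.2.2.2.1 _ (S.le_mem h).1 _ (S.le_mem h).2 _ (S.le_mem h').2 h h'

theorem Setup.refl (S : Setup M P r one G) {p : XM M} (h : p.1 ∈ P.1) : PM p p r :=
  S.hf.2.2.2.2.1 _ h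

theorem Setup.up (S : Setup M P r one G) {p q : XM M} (h : PM p q r) (hp : p.1 ∈ G) : q.1 ∈ G :=
  S.hG.1.2.1 _ hp _ (S.le_mem h).2 h

theorem Setup.GP (S : Setup M P r one G) {p : ZFSet.{u}} (hp : p ∈ G) : p ∈ P.1 :=
  S.hG.1.1 hp

theorem Setup.GM (S : Setup M P r one G) {p : ZFSet.{u}} (hp : p ∈ G) : p ∈ M :=
  S.H.tr (S.GP hp) P.2

theorem Setup.dir (S : Setup M P r one G) {p q : XM M} (hp : p.1 ∈ G) (hq : q.1 ∈ G) :
    ∃ z : XM M, z.1 ∈ G ∧ PM z p r ∧ PM z q r := by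
  obtain ⟨z, hz, h1, h2⟩ := S.hG.1.2.2 _ hp _ hq
  exact ⟨⟨z, S.GM hz⟩, hz, h1, h2⟩

theorem Setup.gen (S : Setup M P r one G) {D : XM M → Prop}
    (hD : Dfn M (fun g : PUnit.{u + 2} × XM M => D g.2))
    (hd : ∀ p : XM M, p.1 ∈ P.1 → ∃ d, PM d p r ∧ D d) : ∃ d : XM M, d.1 ∈ G ∧ D d := by
  obtain ⟨E, hE, hE'⟩ := S.H.sep_mem hD P.2
  obtain ⟨q, hq, hqE⟩ := S.hG.2 E hE (by
    refine ⟨fun x hx => ((hE' ⟨x, S.H.tr hx hE⟩).1 hx).1, fun p hp => ?_⟩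
    obtain ⟨d, h1, h2⟩ := hd ⟨p, S.H.tr hp P.2⟩ hp
    exact ⟨d.1, (hE' d).2 ⟨(S.le_mem h1).1, h2⟩, h1⟩)
  exact ⟨⟨q, S.GM hq⟩, hq, ((hE' ⟨q, S.GM hq⟩).1 hqE).2⟩

theorem Setup.one_mem (S : Setup M P r one G) : one ∈ G := by
  obtain ⟨q, hq, hqE⟩ := S.hG.2 P.1 P.2 ⟨fun x hx => hx, fun p hp =>
    ⟨p, hp, S.hf.2.2.2.2.1 p hp⟩⟩
  exact S.hG.1.2.1 q hq one S.hf.2.2.1 (S.hf.2.2.2.2.2.2 q hqE)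

theorem Setup.gen_below (S : Setup M P r one G) {D : XM M → Prop}
    (hD : Dfn M (fun g : PUnit.{u + 2} × XM M => D g.2)) (p : XM M) (hp : p.1 ∈ G)
    (hd : ∀ q : XM M, PM q p r → ∃ d, PM d q r ∧ D d) : ∃ d : XM M, d.1 ∈ G ∧ D d := by
  obtain ⟨d, hdG, hd'⟩ := S.gen (D := fun d => D d ∨ ∀ e, PM e d r → ¬ PM e p r)
    (Dfn.or hD (Dfn.all (Dfn.imp (S.H.dfn_PM Tm.v0 Tm.v0.up (Tm.c _))
      (Dfn.not (S.H.dfn_PM Tm.v0 (Tm.c _) (Tm.c _)))))) (by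
    intro x hx
    by_cases h : ∃ e, PM e x r ∧ PM e p r
    · obtain ⟨e, h1, h2⟩ := h
      obtain ⟨d, h3, h4⟩ := hd e h2
      exact ⟨d, S.trans h3 h1, Or.inl h4⟩
    · refine ⟨x, S.refl hx, Or.inr fun e h1 h2 => h ⟨e, h1, h2⟩⟩)
  rcases hd' with h | h
  · exact ⟨d, hdG, h⟩
  · obtain ⟨z, -, h1, h2⟩ := S.dir hdG hp
    exact absurd h2 (h z h1)

/-- `B` is the forcing relation for equality of names in `T`. -/
def IsFE (P r T B : XM M) : Prop := ∀ p σ τ : XM M,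
    TMem p σ τ B ↔ (p.1 ∈ P.1 ∧ σ.1 ∈ T.1 ∧ τ.1 ∈ T.1) ∧ Fc P r B p σ τ ∧ Gc P r B p σ τ

theorem Setup.FE_mono (S : Setup M P r one G) {T B : XM M} (hB : IsFE P r T B)
    {p q σ τ : XM M} (h : PM q p r) (hp : TMem p σ τ B) : TMem q σ τ B := by
  obtain ⟨⟨-, h1, h2⟩, h3, h4⟩ := (hB _ _ _).1 hp
  exact (hB _ _ _).2 ⟨⟨(S.le_mem h).1, h1, h2⟩,
    fun a b c d e f g => h3 a b c d e (S.trans f h) g,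
    fun a b c d e f g => h4 a b c d e (S.trans f h) g⟩

theorem Setup.mem_val (S : Setup M P r one G) {x : ZFSet.{u}} {τ : XM M} :
    x ∈ zval G τ.1 ↔ ∃ σ p : XM M, p.1 ∈ G ∧ PM σ p τ ∧ zval G σ.1 = x := by
  rw [mem_zval]
  constructor
  · rintro ⟨σ, p, h1, h2, h3⟩
    have := S.H.of_pair (S.H.tr h2 τ.2)
    exact ⟨⟨σ, this.1⟩, ⟨p, this.2⟩, h1, h2, h3⟩
  · rintro ⟨σ, p, h1, h2, h3⟩
    exact ⟨σ.1, p.1, h1, h2, h3⟩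

theorem Setup.FE_sound (S : Setup M P r one G) {T B : XM M} (hB : IsFE P r T B) (σ : XM M) :
    ∀ p τ : XM M, p.1 ∈ G → TMem p σ τ B → zval G σ.1 = zval G τ.1 := by
  induction h : σ.1.rank using WellFoundedLT.induction generalizing σ with
  | _ o ih =>
  subst h
  intro p τ hp hm
  obtain ⟨⟨-, h1, h2⟩, h3, h4⟩ := (hB _ _ _).1 hm
  ext x
  rw [S.mem_val, S.mem_val]
  constructor
  · rintro ⟨σ', s, hs, hσ', rfl⟩
    obtain ⟨q₀, hq₀, hq₀p, hq₀s⟩ := S.dir hp hs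
    obtain ⟨d, hd, τ', t, k1, k2, k3⟩ := S.gen_below
      (D := fun d => ∃ τ' t, PM τ' t τ ∧ PM d t r ∧ TMem d σ' τ' B)
      (Dfn.ex (Dfn.ex (Dfn.and (S.H.dfn_PM Tm.v0.up Tm.v0 (Tm.c _)) (Dfn.and
        (S.H.dfn_PM Tm.v0.up.up Tm.v0 (Tm.c _))
        (S.H.dfn_TM Tm.v0.up.up (Tm.c _) Tm.v0.up (Tm.c _)))))) q₀ hq₀ (by
      intro q hq
      obtain ⟨r', τ', t, -, k2, k3, k4, k5⟩ :=
        h3 σ' s q hσ' (S.le_mem hq).1 (S.trans hq hq₀p) (S.trans hq hq₀s)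
      exact ⟨r', k2, τ', t, k3, k4, k5⟩)
    exact ⟨τ', t, S.up k2 hd, k1, (ih _ (rank_lt_of_pair hσ') σ' rfl d τ' hd k3).symm⟩
  · rintro ⟨τ', t, ht, hτ', rfl⟩
    obtain ⟨q₀, hq₀, hq₀p, hq₀t⟩ := S.dir hp ht
    obtain ⟨d, hd, σ', s, k1, k2, k3⟩ := S.gen_below
      (D := fun d => ∃ σ' s, PM σ' s σ ∧ PM d s r ∧ TMem d σ' τ' B)
      (Dfn.ex (Dfn.ex (Dfn.and (S.H.dfn_PM Tm.v0.up Tm.v0 (Tm.c _)) (Dfn.and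
        (S.H.dfn_PM Tm.v0.up.up Tm.v0 (Tm.c _))
        (S.H.dfn_TM Tm.v0.up.up Tm.v0.up (Tm.c _) (Tm.c _)))))) q₀ hq₀ (by
      intro q hq
      obtain ⟨r', τ', t, -, k2, k3, k4, k5⟩ :=
        h4 τ' t q hτ' (S.le_mem hq).1 (S.trans hq hq₀p) (S.trans hq hq₀t)
      exact ⟨r', k2, τ', t, k3, k4, k5⟩)
    exact ⟨σ', s, S.up k2 hd, k1, ih _ (rank_lt_of_pair k1) σ' rfl d τ' hd k3⟩

theorem name_mem {T : ZFSet.{u}} (hT : T.IsTransitive) {σ s τ : XM M} (h : PM σ s τ)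
    (hτ : τ.1 ∈ T) : σ.1 ∈ T := by
  have h1 : ZFSet.pair σ.1 s.1 ∈ T := hT _ hτ h
  have h2 : ({σ.1} : ZFSet.{u}) ∈ T := hT _ h1 (by simp [ZFSet.pair])
  exact hT _ h2 (by simp)

theorem Setup.FE_complete (S : Setup M P r one G) {T B : XM M} (hB : IsFE P r T B)
    (hT : T.1.IsTransitive) (σ : XM M) :
    ∀ τ : XM M, σ.1 ∈ T.1 → τ.1 ∈ T.1 → zval G σ.1 = zval G τ.1 →
      ∃ p : XM M, p.1 ∈ G ∧ TMem p σ τ B := by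
  induction h : σ.1.rank using WellFoundedLT.induction generalizing σ with
  | _ o ih =>
  subst h
  intro τ hσT hτT hval
  obtain ⟨p, hp, h⟩ := S.gen
    (D := fun p => TMem p σ τ B ∨
      (∃ σ' s, PM σ' s σ ∧ PM p s r ∧ ∀ q τ' t, PM q p r → PM τ' t τ → PM q t r →
        ¬ TMem q σ' τ' B) ∨
      (∃ τ' t, PM τ' t τ ∧ PM p t r ∧ ∀ q σ' s, PM q p r → PM σ' s σ → PM q s r →
        ¬ TMem q σ' τ' B))
    (Dfn.or (S.H.dfn_TM Tm.v0 (Tm.c _) (Tm.c _) (Tm.c _)) (Dfn.or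
      (Dfn.ex (Dfn.ex (Dfn.and (S.H.dfn_PM Tm.v0.up Tm.v0 (Tm.c _)) (Dfn.and
        (S.H.dfn_PM Tm.v0.up.up Tm.v0 (Tm.c _)) (Dfn.all (Dfn.all (Dfn.all
          (Dfn.imp (S.H.dfn_PM Tm.v0.up.up Tm.v0.up.up.up.up.up (Tm.c _))
          (Dfn.imp (S.H.dfn_PM Tm.v0.up Tm.v0 (Tm.c _))
          (Dfn.imp (S.H.dfn_PM Tm.v0.up.up Tm.v0 (Tm.c _)) (Dfn.not
            (S.H.dfn_TM Tm.v0.up.up Tm.v0.up.up.up.up Tm.v0.up (Tm.c _)))))))))))))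
      (Dfn.ex (Dfn.ex (Dfn.and (S.H.dfn_PM Tm.v0.up Tm.v0 (Tm.c _)) (Dfn.and
        (S.H.dfn_PM Tm.v0.up.up Tm.v0 (Tm.c _)) (Dfn.all (Dfn.all (Dfn.all
          (Dfn.imp (S.H.dfn_PM Tm.v0.up.up Tm.v0.up.up.up.up.up (Tm.c _))
          (Dfn.imp (S.H.dfn_PM Tm.v0.up Tm.v0 (Tm.c _))
          (Dfn.imp (S.H.dfn_PM Tm.v0.up.up Tm.v0 (Tm.c _)) (Dfn.not
            (S.H.dfn_TM Tm.v0.up.up Tm.v0.up Tm.v0.up.up.up.up (Tm.c _)))))))))))))))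
    (by
      intro p hp
      by_cases hm : TMem p σ τ B
      · exact ⟨p, S.refl hp, Or.inl hm⟩
      by_cases hF : Fc P r B p σ τ
      · have hGc : ¬ Gc P r B p σ τ := fun h => hm ((hB _ _ _).2 ⟨⟨hp, hσT, hτT⟩, hF, h⟩)
        unfold Gc at hGc
        push Not at hGc
        obtain ⟨τ', t, q, k1, k2, k3, k4, k5⟩ := hGc
        exact ⟨q, k3, Or.inr (Or.inr ⟨τ', t, k1, k4, fun q' σ' s l1 l2 l3 =>
          k5 q' σ' s (S.le_mem l1).1 l1 l2 l3⟩)⟩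
      · unfold Fc at hF
        push Not at hF
        obtain ⟨τ', t, q, k1, k2, k3, k4, k5⟩ := hF
        exact ⟨q, k3, Or.inr (Or.inl ⟨τ', t, k1, k4, fun q' σ' s l1 l2 l3 =>
          k5 q' σ' s (S.le_mem l1).1 l1 l2 l3⟩)⟩)
  rcases h with h | ⟨σ', s, k1, k2, k3⟩ | ⟨τ', t, k1, k2, k3⟩
  · exact ⟨p, hp, h⟩
  · exfalso
    have hx : zval G σ'.1 ∈ zval G τ.1 := by
      rw [← hval, S.mem_val]
      exact ⟨σ', s, S.up k2 hp, k1, rfl⟩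
    obtain ⟨τ', t, ht, hτ', he⟩ := S.mem_val.1 hx
    obtain ⟨p', hp', hm⟩ := ih _ (rank_lt_of_pair k1) σ' rfl τ' (name_mem hT k1 hσT)
      (name_mem hT hτ' hτT) he.symm
    obtain ⟨z, hz, l1, l2⟩ := S.dir hp hp'
    obtain ⟨w, hw, l3, l4⟩ := S.dir hz ht
    exact k3 w τ' t (S.trans l3 l1) hτ' l4 (S.FE_mono hB (S.trans l3 l2) hm)
  · exfalso
    have hx : zval G τ'.1 ∈ zval G σ.1 := by
      rw [hval, S.mem_val]
      exact ⟨τ', t, S.up k2 hp, k1, rfl⟩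
    obtain ⟨σ', s, hs, hσ', he⟩ := S.mem_val.1 hx
    obtain ⟨p', hp', hm⟩ := ih _ (rank_lt_of_pair hσ') σ' rfl τ' (name_mem hT hσ' hσT)
      (name_mem hT k1 hτT) he
    obtain ⟨z, hz, l1, l2⟩ := S.dir hp hp'
    obtain ⟨w, hw, l3, l4⟩ := S.dir hz hs
    exact k3 w σ' s (S.trans l3 l1) hσ' l4 (S.FE_mono hB (S.trans l3 l2) hm)

theorem Setup.main (S : Setup M P r one G) (τ : XM M) :
    (ZFSet.powerset (zval G τ.1) ∩ genExt M G) ∈ genExt M G := by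
  have H := S.H
  have honeM : one ∈ M := S.GM S.one_mem
  -- the ambient set of pairs
  obtain ⟨R, hR, hR'⟩ := H.sep_mem
    (R := fun w => ∃ σ p t, PEq σ p w ∧ PM σ t τ ∧ PM p t r)
    (Dfn.ex (Dfn.ex (Dfn.ex (Dfn.and (H.dfn_PEq Tm.v0.up.up Tm.v0.up Tm.v0.up.up.up) (Dfn.and
      (H.dfn_PM Tm.v0.up.up Tm.v0 (Tm.c _)) (H.dfn_PM Tm.v0.up Tm.v0 (Tm.c _)))))))
    (H.prod_mem (H.sUnion_mem (H.sUnion_mem τ.2)) P.2)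
  have hR2 : ∀ σ p : XM M, ZFSet.pair σ.1 p.1 ∈ R ↔ ∃ t, PM σ t τ ∧ PM p t r := by
    intro σ p
    rw [hR' ⟨_, H.pair_mem σ.2 p.2⟩]
    constructor
    · rintro ⟨-, σ', p', t, h1, h2⟩
      have h1 : ZFSet.pair σ.1 p.1 = ZFSet.pair σ'.1 p'.1 := h1
      rw [ZFSet.pair_inj] at h1
      have e1 := Subtype.ext h1.1
      have e2 := Subtype.ext h1.2
      subst e1 e2
      exact ⟨t, h2⟩
    · rintro ⟨t, h2⟩
      refine ⟨?_, σ, p, t, rfl, h2⟩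
      show ZFSet.pair _ _ ∈ _
      rw [ZFSet.pair_mem_prod]
      refine ⟨?_, (S.le_mem h2.2).1⟩
      rw [ZFSet.mem_sUnion]
      refine ⟨{σ.1}, ?_, by simp⟩
      rw [ZFSet.mem_sUnion]
      exact ⟨_, h2.1, by simp [ZFSet.pair]⟩
  obtain ⟨Q, hQ, hQ'⟩ := H.pow_mem hR
  rw [mem_genExt]
  refine ⟨ZFSet.prod Q {one}, H.prod_mem hQ (H.sing_mem honeM), ?_⟩
  ext c
  rw [mem_zval, ZFSet.mem_inter, ZFSet.mem_powerset, mem_genExt]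
  constructor
  · rintro ⟨θ, p, hp, hθ, rfl⟩
    rw [ZFSet.pair_mem_prod] at hθ
    obtain ⟨hθM, hθR⟩ := (hQ' θ).1 hθ.1
    refine ⟨?_, θ, hθM, rfl⟩
    intro x hx
    obtain ⟨σ, q, hq, hσ, rfl⟩ := (S.mem_val (τ := ⟨θ, hθM⟩)).1 hx
    obtain ⟨t, h1, h2⟩ := (hR2 σ q).1 (hθR hσ)
    exact S.mem_val.2 ⟨σ, t, S.up h2 hq, h1, rfl⟩
  · rintro ⟨hsub, χ, hχ, rfl⟩
    obtain ⟨T, hTM, hτT, hχT, hT⟩ := H.exists_trans τ.2 hχ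
    obtain ⟨B, hB⟩ := H.exists_forceEq P r ⟨T, hTM⟩
    have hB : IsFE P r ⟨T, hTM⟩ B := hB
    obtain ⟨θ, hθ, hθ'⟩ := H.sep_mem
      (R := fun w => ∃ σ p χ' t, PEq σ p w ∧ PM χ' t (⟨χ, hχ⟩ : XM M) ∧ PM p t r ∧
        TMem p σ χ' B)
      (Dfn.ex (Dfn.ex (Dfn.ex (Dfn.ex (Dfn.and
        (H.dfn_PEq Tm.v0.up.up.up Tm.v0.up.up Tm.v0.up.up.up.up) (Dfn.and
        (H.dfn_PM Tm.v0.up Tm.v0 (Tm.c _)) (Dfn.and (H.dfn_PM Tm.v0.up.up Tm.v0 (Tm.c _))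
        (H.dfn_TM Tm.v0.up.up Tm.v0.up.up.up Tm.v0.up (Tm.c _)))))))))
      hR
    refine ⟨θ, one, S.one_mem, ?_, ?_⟩
    · rw [ZFSet.pair_mem_prod]
      exact ⟨(hQ' θ).2 ⟨hθ, fun x hx => ((hθ' ⟨x, H.tr hx hθ⟩).1 hx).1⟩, by simp⟩
    · ext x
      constructor
      · intro hx
        obtain ⟨σ, p, hp, hσ, rfl⟩ := (S.mem_val (τ := ⟨θ, hθ⟩)).1 hx
        obtain ⟨-, σ', p', χ', t, h1, h2, h3, h4⟩ :=
          (hθ' ⟨_, H.pair_mem σ.2 p.2⟩).1 hσ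
        have h1 : ZFSet.pair σ.1 p.1 = ZFSet.pair σ'.1 p'.1 := h1
        rw [ZFSet.pair_inj] at h1
        have e1 := Subtype.ext h1.1
        have e2 := Subtype.ext h1.2
        subst e1 e2
        exact (S.mem_val (τ := ⟨χ, hχ⟩)).2
          ⟨χ', t, S.up h3 hp, h2, (S.FE_sound hB σ p χ' hp h4).symm⟩
      · intro hx
        obtain ⟨σ, s, hs, hσ, hσx⟩ := S.mem_val.1 (hsub hx)
        obtain ⟨χ', t, ht, hχ', hχx⟩ := (S.mem_val (τ := ⟨χ, hχ⟩)).1 hx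
        obtain ⟨p, hp, hm⟩ := S.FE_complete hB hT σ χ' (name_mem hT hσ hτT)
          (name_mem (τ := ⟨χ, hχ⟩) hT hχ' hχT) (hσx.trans hχx.symm)
        obtain ⟨z, hz, l1, l2⟩ := S.dir hp hs
        obtain ⟨w, hw, l3, l4⟩ := S.dir hz ht
        refine (S.mem_val (τ := ⟨θ, hθ⟩)).2 ⟨σ, w, hw, ?_, hσx⟩
        refine (hθ' ⟨_, H.pair_mem σ.2 w.2⟩).2 ⟨?_, σ, w, χ', t, rfl, hχ', l4, ?_⟩
        · exact (hR2 σ w).2 ⟨s, hσ, S.trans l3 l2⟩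
        · exact S.FE_mono hB (S.trans l3 l1) hm

end Forcing


end Aux

/-- for `a ∈ M[G]`, the set `𝒫(a) ∩ M[G]` is an element of `M[G]`. -/
theorem Pow_inter_genExt (M : ZFSet) (hcount : M.toSet.Countable)
    (htrans : M.IsTransitive) (hmodel : ZModels M ZF)
    (P r one : ZFSet) (hforcing : ForcingNotion M P r one)
    (G : ZFSet) (hG : IsGeneric M r P G) :
    ∀ a ∈ genExt M G, (ZFSet.powerset a ∩ genExt M G) ∈ genExt M G := by
  intro a ha
  obtain ⟨τ, hτ, rfl⟩ := mem_genExt.1 ha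
  have S : Setup M ⟨P, hforcing.1⟩ ⟨r, hforcing.2.1⟩ one G := ⟨⟨htrans, hmodel⟩, hforcing, hG⟩
  exact S.main ⟨τ, hτ⟩

end CtmForcing
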